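/- arXiv:2504.19832 — 2 statements merged into one kernel-verified Lean document; each statement's English description precedes it below -/
import Mathlib

section
/- Let U be a real-valued random variable with U ≥ 0 almost surely and E[U³] < ∞. Let μ₂ = E[(U − E[U])²] and μ₃ = E[(U − E[U])³] denote its second and third central moments, and assume μ₂ > 0. Then E[U] ≥ (−μ₃ + √(μ₃² + 4μ₂³)) / (2μ₂). Equivalently, writing σ = √μ₂ for the standard deviation and γ = μ₃/μ₂^{3/2} for the skewness, E[U] ≥ (σ/2)(−γ + √(γ² + 4)). -/
open MeasureTheory

/-- Skewness-based lower bound on the mean of a nonnegative random variable: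
`E[U] ≥ (-μ₃ + √(μ₃² + 4 μ₂³)) / (2 μ₂)`. -/
theorem skewness_lower_bound
    {Ω : Type*} [MeasurableSpace Ω] (μ : Measure Ω) [IsProbabilityMeasure μ]
    (U : Ω → ℝ) (hUmeas : AEMeasurable U μ) (hU0 : ∀ᵐ ω ∂μ, 0 ≤ U ω)
    (hU3 : Integrable (fun ω => (U ω) ^ 3) μ)
    (μ2 μ3 : ℝ)
    (hμ2 : μ2 = ∫ ω, (U ω - ∫ ω', U ω' ∂μ) ^ 2 ∂μ)
    (hμ3 : μ3 = ∫ ω, (U ω - ∫ ω', U ω' ∂μ) ^ 3 ∂μ)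
    (hμ2pos : 0 < μ2) :
    (∫ ω, U ω ∂μ) ≥ (-μ3 + Real.sqrt (μ3 ^ 2 + 4 * μ2 ^ 3)) / (2 * μ2) := by
  have hsm := hUmeas.aestronglyMeasurable
  have hi1 : Integrable U μ := by
    refine ((integrable_const (1:ℝ)).add hU3).mono' hsm ?_
    filter_upwards [hU0] with ω h
    simp only [Pi.add_apply, Real.norm_eq_abs, abs_of_nonneg h]
    nlinarith [mul_nonneg h (sq_nonneg (U ω - 1)), sq_nonneg (U ω - 1)]
  have hi2 : Integrable (fun ω => (U ω) ^ 2) μ := by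
    refine ((integrable_const (1:ℝ)).add hU3).mono' (hsm.pow 2) ?_
    filter_upwards [hU0] with ω h
    simp only [Pi.add_apply, Real.norm_eq_abs, abs_of_nonneg (pow_nonneg h 2)]
    nlinarith [mul_nonneg h (sq_nonneg (U ω - 1)), sq_nonneg (U ω - 1)]
  have hm0 : 0 ≤ ∫ ω, U ω ∂μ := integral_nonneg_of_ae hU0
  have key : ∀ a b c d : ℝ, ∫ ω, (a * U ω ^ 3 + b * U ω ^ 2 + c * U ω + d) ∂μ
      = a * ∫ ω, U ω ^ 3 ∂μ + b * ∫ ω, U ω ^ 2 ∂μ + c * ∫ ω, U ω ∂μ + d := by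
    intro a b c d
    have h3 := hU3.const_mul a
    have h2 := hi2.const_mul b
    have h1 := hi1.const_mul c
    have h32 : Integrable (fun ω => a * U ω ^ 3 + b * U ω ^ 2) μ := h3.add h2
    have h321 : Integrable (fun ω => a * U ω ^ 3 + b * U ω ^ 2 + c * U ω) μ := h32.add h1
    rw [integral_add h321 (integrable_const d), integral_add h32 h1, integral_add h3 h2]
    simp only [integral_const_mul]
    simp
  generalize (∫ ω, U ω ∂μ) = m at *
  have e2 : μ2 = (∫ ω, U ω ^ 2 ∂μ) - m ^ 2 := by
    have := key 0 1 (-2 * m) (m ^ 2)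
    rw [hμ2, show (fun ω => (U ω - m) ^ 2)
      = fun ω => 0 * U ω ^ 3 + 1 * U ω ^ 2 + (-2 * m) * U ω + m ^ 2 by ext; ring, this]
    ring
  have e3 : μ3 = (∫ ω, U ω ^ 3 ∂μ) - 3 * m * (∫ ω, U ω ^ 2 ∂μ) + 2 * m ^ 3 := by
    have := key 1 (-3 * m) (3 * m ^ 2) (-m ^ 3)
    rw [hμ3, show (fun ω => (U ω - m) ^ 3)
      = fun ω => 1 * U ω ^ 3 + (-3 * m) * U ω ^ 2 + (3 * m ^ 2) * U ω + (-m ^ 3) by ext; ring,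
      this]
    ring
  have hc : ∀ c : ℝ, 0 ≤ μ3 - 2 * c * μ2 + m * μ2 + m * c ^ 2 := by
    intro c
    have h0 : 0 ≤ ∫ ω, U ω * (U ω - m - c) ^ 2 ∂μ := by
      apply integral_nonneg_of_ae
      filter_upwards [hU0] with ω h
      exact mul_nonneg h (sq_nonneg _)
    have := key 1 (-2 * (m + c)) ((m + c) ^ 2) 0
    rw [show (fun ω => U ω * (U ω - m - c) ^ 2)
      = fun ω => 1 * U ω ^ 3 + (-2 * (m + c)) * U ω ^ 2 + ((m + c) ^ 2) * U ω + 0 by ext; ring,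
      this] at h0
    rw [e3, e2]
    linarith
  have hmpos : 0 < m := by
    rcases hm0.lt_or_eq with h | h
    · exact h
    · exfalso
      have := hc ((μ3 + 1) / (2 * μ2))
      have e : 2 * ((μ3 + 1) / (2 * μ2)) * μ2 = μ3 + 1 := by field_simp
      rw [e, ← h] at this
      linarith
  have hq : 0 ≤ m ^ 2 * μ2 + m * μ3 - μ2 ^ 2 := by
    have := mul_nonneg hmpos.le (hc (μ2 / m))
    have e : m * (μ3 - 2 * (μ2 / m) * μ2 + m * μ2 + m * (μ2 / m) ^ 2)
      = m ^ 2 * μ2 + m * μ3 - μ2 ^ 2 := by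
      field_simp
      ring
    rwa [e] at this
  have hp : 0 < m * μ2 + μ3 := by
    have : 0 < m * (m * μ2 + μ3) := by nlinarith [pow_pos hμ2pos 2]
    exact pos_of_mul_pos_right this hmpos.le
  have hs : Real.sqrt (μ3 ^ 2 + 4 * μ2 ^ 3) ≤ 2 * μ2 * m + μ3 := by
    apply Real.sqrt_le_iff.2
    constructor
    · nlinarith [mul_pos hmpos hμ2pos]
    · nlinarith [mul_nonneg hμ2pos.le hq]
  rw [ge_iff_le, div_le_iff₀ (by positivity)]
  linarith
end

section
/- Let U be a real-valued random variable with U ≥ 0 almost surely, E[U³] < ∞, second central moment μ₂ = E[(U − E[U])²] > 0, and third central moment μ₃ = E[(U − E[U])³] ≤ 0 (i.e., nonpositive skewness). Then E[U] ≥ √μ₂, that is, the mean is at least the standard deviation. -/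
open MeasureTheory

/-- If `U ≥ 0` a.s. has finite third moment, positive variance and nonpositive
third central moment (nonpositive skewness), then `E[U] ≥ √μ₂`. -/
theorem mean_ge_stddev_of_nonpos_skewness
    {Ω : Type*} [MeasurableSpace Ω] (μ : Measure Ω) [IsProbabilityMeasure μ]
    (U : Ω → ℝ) (hUmeas : AEMeasurable U μ) (hU0 : ∀ᵐ ω ∂μ, 0 ≤ U ω)
    (hU3 : Integrable (fun ω => (U ω) ^ 3) μ)
    (μ2 μ3 : ℝ)
    (hμ2 : μ2 = ∫ ω, (U ω - ∫ ω', U ω' ∂μ) ^ 2 ∂μ)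
    (hμ3 : μ3 = ∫ ω, (U ω - ∫ ω', U ω' ∂μ) ^ 3 ∂μ)
    (hμ2pos : 0 < μ2) (hμ3nonpos : μ3 ≤ 0) :
    (∫ ω, U ω ∂μ) ≥ Real.sqrt μ2 := by
  have hm := hUmeas.aestronglyMeasurable
  have h1 : Integrable U μ := by
    refine ((integrable_const (1:ℝ)).add hU3).mono' hm ?_
    filter_upwards [hU0] with ω h
    simp only [Real.norm_eq_abs, abs_of_nonneg h, Pi.add_apply]
    nlinarith [mul_nonneg h (sq_nonneg (U ω - 1)), sq_nonneg (U ω - 1)]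
  have h2 : Integrable (fun ω => (U ω) ^ 2) μ := by
    refine ((integrable_const (1:ℝ)).add hU3).mono' (hm.pow 2) ?_
    filter_upwards [hU0] with ω h
    simp only [Real.norm_eq_abs, abs_of_nonneg (sq_nonneg (U ω)), Pi.add_apply]
    nlinarith [mul_nonneg h (sq_nonneg (U ω - 1)), sq_nonneg (U ω - 1)]
  set m := ∫ ω, U ω ∂μ with hmdef
  have i1 : Integrable (fun ω => U ω - m) μ := h1.sub (integrable_const m)
  have i2 : Integrable (fun ω => (U ω - m) ^ 2) μ := by
    have := (h2.sub (h1.const_mul (2 * m))).add (integrable_const (m ^ 2))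
    refine this.congr (Filter.Eventually.of_forall fun ω => ?_)
    simp only [Pi.add_apply, Pi.sub_apply]
    ring
  have i3 : Integrable (fun ω => (U ω - m) ^ 3) μ := by
    have := ((hU3.sub (h2.const_mul (3 * m))).add (h1.const_mul (3 * m ^ 2))).sub
      (integrable_const (m ^ 3))
    refine this.congr (Filter.Eventually.of_forall fun ω => ?_)
    simp only [Pi.add_apply, Pi.sub_apply]
    ring
  have e1 : ∫ ω, (U ω - m) ∂μ = 0 := by
    rw [integral_sub h1 (integrable_const m)]
    simp [hmdef]
  obtain ⟨s, hs⟩ : ∃ s, s = Real.sqrt μ2 := ⟨_, rfl⟩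
  have hspos : 0 < s := hs ▸ Real.sqrt_pos.mpr hμ2pos
  have hs2 : s ^ 2 = μ2 := hs ▸ Real.sq_sqrt hμ2pos.le
  have key : 0 ≤ ∫ ω, U ω * (U ω - m - s) ^ 2 ∂μ := by
    apply integral_nonneg_of_ae
    filter_upwards [hU0] with ω h
    exact mul_nonneg h (sq_nonneg _)
  have e : ∫ ω, U ω * (U ω - m - s) ^ 2 ∂μ
      = μ3 + (m - 2 * s) * μ2 + m * s ^ 2 := by
    have : (fun ω => U ω * (U ω - m - s) ^ 2) = fun ω =>
        (((U ω - m) ^ 3 + (m - 2 * s) * (U ω - m) ^ 2)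
          + (s ^ 2 - 2 * s * m) * (U ω - m)) + m * s ^ 2 := by
      funext ω
      ring
    have j2 : Integrable (fun ω => (U ω - m) ^ 3 + (m - 2 * s) * (U ω - m) ^ 2) μ :=
      i3.add (i2.const_mul _)
    have j1 : Integrable (fun ω => ((U ω - m) ^ 3 + (m - 2 * s) * (U ω - m) ^ 2)
          + (s ^ 2 - 2 * s * m) * (U ω - m)) μ := j2.add (i1.const_mul _)
    rw [this, integral_add j1 (integrable_const _), integral_add j2 (i1.const_mul _),
      integral_add i3 (i2.const_mul _), integral_const_mul, integral_const_mul, e1, ← hμ2, ← hμ3]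
    simp
  rw [e, ← hs2] at key
  rw [← hs]
  by_contra hlt
  have hlt : 0 < s - m := by linarith [not_le.mp hlt]
  have : 0 < (s - m) * s ^ 2 := by positivity
  nlinarith
end
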